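/- arXiv:2211.16784 — 4 statements merged into one kernel-verified Lean document; each statement's English description precedes it below -/
import Mathlib

section
/- Let A be an n×n real symmetric positive semidefinite matrix with trace 1, let α > 0 with α ≠ 1, and let k be an integer with 1 ≤ k ≤ n−1. Then 0 ≤ S_α^k(A) ≤ log₂(n), and the maximum is attained at the matrix (1/n)·I_n, i.e. S_α^k((1/n)·I_n) = log₂(n). -/
open scoped BigOperators

/-- The eigenvalues of a real symmetric matrix, sorted in nonincreasing order
    (returns `0` if the matrix is not symmetric). -/
noncomputable def eigs {n : ℕ} (A : Matrix (Fin n) (Fin n) ℝ) : Fin n → ℝ :=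
  if h : A.IsHermitian then
    fun i => (h.eigenvalues ∘ Tuple.sort h.eigenvalues) i.rev
  else 0

/-- The sum of `f i` over the indices `i < k` (the `k` largest eigenvalues when
    `f` is nonincreasing). -/
noncomputable def topSum {n : ℕ} (k : ℕ) (f : Fin n → ℝ) : ℝ :=
  ∑ i ∈ Finset.univ.filter fun i : Fin n => (i : ℕ) < k, f i

/-- `λ_r(A) = (1 - ∑_{i=1}^k λ_i(A)) / (n - k)`. -/
noncomputable def lamR {n : ℕ} (k : ℕ) (A : Matrix (Fin n) (Fin n) ℝ) : ℝ :=
  (1 - topSum k (eigs A)) / ((n : ℝ) - (k : ℝ))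

/-- Low-rank matrix-based Rényi entropy
    `S_α^k(A) = (1/(1-α)) log₂(∑_{i=1}^k λ_i(A)^α + (n-k) λ_r(A)^α)`. -/
noncomputable def Slow {n : ℕ} (α : ℝ) (k : ℕ) (A : Matrix (Fin n) (Fin n) ℝ) : ℝ :=
  (1 / (1 - α)) * Real.logb 2
    (topSum k (fun i => eigs A i ^ α) + ((n : ℝ) - (k : ℝ)) * lamR k A ^ α)

/-- Matrix-based Rényi entropy `S_α(A) = (1/(1-α)) log₂(∑_{i=1}^n λ_i(A)^α)`. -/
noncomputable def Sfull {n : ℕ} (α : ℝ) (A : Matrix (Fin n) (Fin n) ℝ) : ℝ :=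
  (1 / (1 - α)) * Real.logb 2 (∑ i, eigs A i ^ α)

theorem mul_inv_rpow_eq_rpow_one_sub {x : ℝ} (hx : 0 < x) (α : ℝ) :
    x * x⁻¹ ^ α = x ^ (1 - α) := by
  rw [Real.inv_rpow hx.le, Real.rpow_sub hx, Real.rpow_one, div_eq_mul_inv]

/-- The Rényi entropy of a probability vector is nonnegative and at most `log₂ n`. -/
theorem renyi_nonneg_le_logb {n : ℕ} (p : Fin n → ℝ) (α : ℝ) (hp : ∀ i, 0 ≤ p i)
    (hsum : ∑ i, p i = 1) (hα : 0 < α) (hα1 : α ≠ 1) :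
    0 ≤ (1 / (1 - α)) * Real.logb 2 (∑ i, p i ^ α) ∧
      (1 / (1 - α)) * Real.logb 2 (∑ i, p i ^ α) ≤ Real.logb 2 n := by
  have hn : 0 < (n : ℝ) := by
    rcases Nat.eq_zero_or_pos n with rfl | h
    · simp at hsum
    · exact_mod_cast h
  have hp1 (i : Fin n) : p i ≤ 1 :=
    hsum ▸ Finset.single_le_sum (fun j _ => hp j) (Finset.mem_univ i)
  have hw : ∑ _i : Fin n, (n : ℝ)⁻¹ = 1 := by simp [hn.ne']
  have hpow : (n : ℝ) * (n : ℝ)⁻¹ ^ α = (n : ℝ) ^ (1 - α) :=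
    mul_inv_rpow_eq_rpow_one_sub hn α
  have hlog : Real.logb 2 ((n : ℝ) ^ (1 - α)) = (1 - α) * Real.logb 2 n :=
    Real.logb_rpow_eq_mul_logb_of_pos hn
  have hnpow : 0 < (n : ℝ) ^ (1 - α) := Real.rpow_pos_of_pos hn _
  rcases lt_or_gt_of_ne hα1 with h | h
  · have lower : 1 ≤ ∑ i, p i ^ α := by
      rw [← hsum]
      exact Finset.sum_le_sum fun i _ => Real.self_le_rpow_of_le_one (hp i) (hp1 i) h.le
    have jensen := (Real.concaveOn_rpow hα.le h.le).le_map_sum (t := Finset.univ)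
      (w := fun _ : Fin n => (n : ℝ)⁻¹) (p := p) (fun _ _ => by positivity) hw
      (fun i _ => hp i)
    simp only [smul_eq_mul, ← Finset.mul_sum, hsum, mul_one] at jensen
    rw [inv_mul_le_iff₀ hn, hpow] at jensen
    have h0 : 0 < 1 - α := by linarith
    rw [one_div, inv_mul_le_iff₀ h0, ← hlog]
    exact ⟨mul_nonneg (by positivity) (Real.logb_nonneg (by norm_num) lower),
      Real.logb_le_logb_of_le (by norm_num) (by linarith) jensen⟩
  · have upper : ∑ i, p i ^ α ≤ 1 := by
      rw [← hsum]
      exact Finset.sum_le_sum fun i _ => Real.rpow_le_self_of_le_one (hp i) (hp1 i) h.le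
    have jensen := (convexOn_rpow h.le).map_sum_le (t := Finset.univ)
      (w := fun _ : Fin n => (n : ℝ)⁻¹) (p := p) (fun _ _ => by positivity) hw
      (fun i _ => hp i)
    simp only [smul_eq_mul, ← Finset.mul_sum, hsum, mul_one] at jensen
    rw [le_inv_mul_iff₀ hn, hpow] at jensen
    have h0 : 1 - α < 0 := by linarith
    rw [one_div, ← div_eq_inv_mul, div_le_iff_of_neg h0, mul_comm (Real.logb 2 n), ← hlog]
    exact ⟨div_nonneg_of_nonpos
        (Real.logb_nonpos (by norm_num) (hnpow.le.trans jensen) upper) h0.le,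
      Real.logb_le_logb_of_le (by norm_num) hnpow jensen⟩

theorem topSum_add_mul_eq_sum_ite {n k : ℕ} (hk : k ≤ n) (f : Fin n → ℝ) (c : ℝ) :
    topSum k f + ((n : ℝ) - k) * c = ∑ i : Fin n, if (i : ℕ) < k then f i else c := by
  have hcard : (Finset.univ.filter fun i : Fin n => (i : ℕ) < k).card = k := by
    simp [Fin.card_filter_val_lt, hk]
  have hcard' : ((Finset.univ.filter fun i : Fin n => ¬ (i : ℕ) < k).card : ℝ) = n - k := by
    have h := Finset.card_filter_add_card_filter_not (s := (Finset.univ : Finset (Fin n)))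
      (fun i : Fin n => (i : ℕ) < k)
    rw [hcard, Finset.card_univ, Fintype.card_fin] at h
    rw [eq_sub_iff_add_eq']
    exact_mod_cast h
  rw [Finset.sum_ite, Finset.sum_const, nsmul_eq_mul, hcard', topSum]

theorem sum_eigs {n : ℕ} {A : Matrix (Fin n) (Fin n) ℝ} (hA : A.IsHermitian) :
    ∑ i, eigs A i = A.trace := by
  simp only [eigs, dif_pos hA, Function.comp_apply]
  calc
    _ = ∑ i, hA.eigenvalues (Tuple.sort hA.eigenvalues i) :=
      Equiv.sum_comp Fin.revPerm fun i => hA.eigenvalues (Tuple.sort hA.eigenvalues i)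
    _ = ∑ i, hA.eigenvalues i := Equiv.sum_comp _ hA.eigenvalues
    _ = A.trace := by simp [hA.trace_eq_sum_eigenvalues]

theorem eigs_nonneg {n : ℕ} {A : Matrix (Fin n) (Fin n) ℝ} (hA : A.PosSemidef) (i : Fin n) :
    0 ≤ eigs A i := by
  simp only [eigs, dif_pos hA.isHermitian, Function.comp_apply]
  exact hA.eigenvalues_nonneg _

theorem eigs_smul_one {n : ℕ} (c : ℝ) (i : Fin n) :
    eigs (c • (1 : Matrix (Fin n) (Fin n) ℝ)) i = c := by
  have hH : (c • (1 : Matrix (Fin n) (Fin n) ℝ)).IsHermitian := by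
    simp [Matrix.IsHermitian]
  have : Nonempty (Fin n) := ⟨i⟩
  simp only [eigs, dif_pos hH, Function.comp_apply]
  have h := hH.eigenvalues_mem_spectrum_real (Tuple.sort hH.eigenvalues i.rev)
  have hspec : spectrum ℝ (c • (1 : Matrix (Fin n) (Fin n) ℝ)) = {c} := by
    rw [← Algebra.algebraMap_eq_smul_one, spectrum.scalar_eq]
  exact hspec.subset h

theorem topSum_eigs_le_trace {n : ℕ} {A : Matrix (Fin n) (Fin n) ℝ} (hA : A.PosSemidef)
    (k : ℕ) : topSum k (eigs A) ≤ A.trace := by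
  rw [← sum_eigs hA.isHermitian]
  exact Finset.sum_le_sum_of_subset_of_nonneg (Finset.filter_subset _ _)
    fun i _ _ => eigs_nonneg hA i

/-- `0 ≤ S_α^k(A) ≤ log₂ n`, with the maximum attained at `(1/n)·I`. -/
theorem lowRank_entropy_nonneg_le_log {n : ℕ} (A : Matrix (Fin n) (Fin n) ℝ)
    (α : ℝ) (k : ℕ)
    (hA : A.PosSemidef) (htr : A.trace = 1)
    (hα : 0 < α) (hα1 : α ≠ 1) (hk1 : 1 ≤ k) (hkn : k ≤ n - 1) :
    0 ≤ Slow α k A ∧ Slow α k A ≤ Real.logb 2 n ∧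
      Slow α k (((n : ℝ)⁻¹) • (1 : Matrix (Fin n) (Fin n) ℝ)) = Real.logb 2 n := by
  have hkn' : k < n := by omega
  have hn : (n : ℝ) ≠ 0 := by
    have : n ≠ 0 := by omega
    exact_mod_cast this
  have hd : 0 < (n : ℝ) - k := sub_pos.mpr (by exact_mod_cast hkn')
  have hr : 0 ≤ lamR k A :=
    div_nonneg (sub_nonneg.mpr (htr ▸ topSum_eigs_le_trace hA k)) hd.le
  have hbound := renyi_nonneg_le_logb
    (fun i : Fin n => if (i : ℕ) < k then eigs A i else lamR k A) α
    (fun i => by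
      split_ifs
      exacts [eigs_nonneg hA i, hr])
    (by
      rw [← topSum_add_mul_eq_sum_ite hkn'.le, lamR, mul_div_cancel₀ _ hd.ne']
      ring)
    hα hα1
  simp only [apply_ite (fun x : ℝ => x ^ α)] at hbound
  rw [← topSum_add_mul_eq_sum_ite hkn'.le] at hbound
  refine ⟨hbound.1, hbound.2, ?_⟩
  have heigs : eigs ((n : ℝ)⁻¹ • (1 : Matrix (Fin n) (Fin n) ℝ)) = fun _ => (n : ℝ)⁻¹ :=
    funext (eigs_smul_one _)
  have htop (c : ℝ) : topSum k (fun _ : Fin n => c) + ((n : ℝ) - k) * c = n * c := by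
    simp [topSum_add_mul_eq_sum_ite hkn'.le]
  have hlam : lamR k ((n : ℝ)⁻¹ • (1 : Matrix (Fin n) (Fin n) ℝ)) = (n : ℝ)⁻¹ := by
    rw [lamR, heigs, div_eq_iff hd.ne']
    have h := htop (n : ℝ)⁻¹
    rw [mul_inv_cancel₀ hn] at h
    linarith
  have hpos : 0 < (n : ℝ) := by positivity
  rw [Slow, hlam, heigs, htop, mul_inv_rpow_eq_rpow_one_sub hpos,
    Real.logb_rpow_eq_mul_logb_of_pos hpos, one_div,
    inv_mul_cancel_left₀ (sub_ne_zero.mpr hα1.symm)]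
end

section
/- Let α > 0 with α ≠ 1. Let λ_1 ≥ … ≥ λ_n > 0 and λ̂_1, …, λ̂_n > 0 be reals such that |λ_i − λ̂_i| ≤ ε for every i ∈ [1,n], where 0 < ε < λ_n. Then the corresponding Rényi entropies S_α(λ) = (1/(1−α)) log₂(∑_{i=1}^n λ_i^α) and S_α(λ̂) = (1/(1−α)) log₂(∑_{i=1}^n λ̂_i^α) satisfy |S_α(λ) − S_α(λ̂)| ≤ | (α/(1−α)) · log₂(1 − ε/λ_n) |. -/
open scoped BigOperators

/-- A pointwise lower bound `r * x i ≤ y i` carries over to the logarithms of the power sums. -/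
lemma mul_logb_add_logb_sum_rpow_le {ι : Type*} [Fintype ι] [Nonempty ι] {b α r : ℝ} {x y : ι → ℝ}
    (hb : 1 < b) (hα : 0 ≤ α) (hr : 0 < r) (hx : ∀ i, 0 < x i) (hxy : ∀ i, r * x i ≤ y i) :
    α * Real.logb b r + Real.logb b (∑ i, x i ^ α) ≤ Real.logb b (∑ i, y i ^ α) := by
  have hsum : 0 < ∑ i, x i ^ α :=
    Finset.sum_pos (fun i _ => Real.rpow_pos_of_pos (hx i) α) Finset.univ_nonempty
  have hrα : 0 < r ^ α := Real.rpow_pos_of_pos hr α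
  rw [← Real.logb_rpow_eq_mul_logb_of_pos hr, ← Real.logb_mul hrα.ne' hsum.ne', Finset.mul_sum]
  refine Real.logb_le_logb_of_le hb (by rw [← Finset.mul_sum]; positivity)
    (Finset.sum_le_sum fun i _ => ?_)
  rw [← Real.mul_rpow hr.le (hx i).le]
  exact Real.rpow_le_rpow (mul_pos hr (hx i)).le (hxy i) hα

/-- Proposition 2 of the paper: if every eigenvalue of a positive sequence
`λ₁ ≥ … ≥ λₙ > 0` is approximated to absolute error `ε < λₙ` by a positive sequence `λ̂`,
then the Rényi entropies `S_α(λ) = (1/(1-α)) log₂ (∑ λᵢ^α)` differ by at most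
`|(α/(1-α)) log₂ (1 - ε/λₙ)|`. -/
theorem renyi_entropy_abs_perturbation_bound {n : ℕ} (hn : 0 < n)
    (lam lamh : Fin n → ℝ) (α ε : ℝ)
    (hα : 0 < α) (hα1 : α ≠ 1)
    (hanti : Antitone lam) (hpos : 0 < lam ⟨n - 1, by omega⟩)
    (hhat : ∀ i, 0 < lamh i)
    (hε : 0 < ε) (hεlt : ε < lam ⟨n - 1, by omega⟩)
    (hclose : ∀ i, |lam i - lamh i| ≤ ε) :
    |(1 / (1 - α)) * Real.logb 2 (∑ i, lam i ^ α) -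
        (1 / (1 - α)) * Real.logb 2 (∑ i, lamh i ^ α)| ≤
      |(α / (1 - α)) * Real.logb 2 (1 - ε / lam ⟨n - 1, by omega⟩)| := by
  have : Nonempty (Fin n) := ⟨⟨0, hn⟩⟩
  have hmin : ∀ i, lam ⟨n - 1, by omega⟩ ≤ lam i := fun i =>
    hanti (Fin.le_def.mpr (Nat.le_sub_one_of_lt i.isLt))
  set m := lam ⟨n - 1, by omega⟩
  set r := 1 - ε / m with hr_def
  have hδ : 0 < ε / m := div_pos hε hpos
  have hr : 0 < r := sub_pos.mpr ((div_lt_one hpos).mpr hεlt)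
  have hεle : ∀ i, ε ≤ ε / m * lam i := fun i => by
    calc ε = ε / m * m := (div_mul_cancel₀ ε hpos.ne').symm
      _ ≤ ε / m * lam i := mul_le_mul_of_nonneg_left (hmin i) hδ.le
  have hlam : ∀ i, 0 < lam i := fun i => hpos.trans_le (hmin i)
  have h₁ := mul_logb_add_logb_sum_rpow_le one_lt_two hα.le hr hlam (y := lamh) fun i => by
    have := (abs_le.mp (hclose i)).2
    linarith [hεle i, sub_mul 1 (ε / m) (lam i)]
  have h₂ := mul_logb_add_logb_sum_rpow_le one_lt_two hα.le hr hhat (y := lam) fun i => by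
    have := (abs_le.mp (hclose i)).1
    calc r * lamh i ≤ r * (lam i + ε / m * lam i) :=
          mul_le_mul_of_nonneg_left (by linarith [hεle i]) hr.le
      _ ≤ lam i := by
          rw [hr_def]
          nlinarith [mul_nonneg (sq_nonneg (ε / m)) (hlam i).le]
  have hdiff : |Real.logb 2 (∑ i, lam i ^ α) - Real.logb 2 (∑ i, lamh i ^ α)| ≤
      |α * Real.logb 2 r| :=
    (abs_le.mpr ⟨by linarith, by linarith⟩).trans (neg_le_abs (α * Real.logb 2 r))
  have hfactor : α / (1 - α) * Real.logb 2 r = 1 / (1 - α) * (α * Real.logb 2 r) := by ring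
  rw [← mul_sub, hfactor, abs_mul, abs_mul (1 / (1 - α))]
  exact mul_le_mul_of_nonneg_left hdiff (abs_nonneg _)
end

section
/- Let n ≥ 2, let k be an integer with 1 ≤ k ≤ n/2, and let α > 0 with α ≠ 1. Let λ_1 ≥ … ≥ λ_n ≥ 0 with ∑_{i=1}^n λ_i = 1, set λ_r = (1/(n−k))(1 − ∑_{i=1}^k λ_i), and assume λ_r > 0. Fix ε ∈ (0,1) and suppose λ̂_1, …, λ̂_k ≥ 0 satisfy |λ̂_i − λ_i| ≤ ελ_r for every i ∈ [1,k]; set λ̂_r = (1/(n−k))(1 − ∑_{i=1}^k λ̂_i). Then |λ̂_r − λ_r| ≤ ελ_r, and the exact and approximate low-rank Rényi entropies S = (1/(1−α)) log₂(∑_{i=1}^k λ_i^α + (n−k)λ_r^α) and Ŝ = (1/(1−α)) log₂(∑_{i=1}^k λ̂_i^α + (n−k)λ̂_r^α) satisfy |S − Ŝ| ≤ | (α/(1−α)) log₂(1 − ε) |. -/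
open scoped BigOperators

/-- A termwise bound `c * f i ≤ g i` passes, with factor `c ^ α`, to the sums of `α`-th powers
with an extra term of weight `m`. -/
theorem rpow_mul_sum_rpow_le {ι : Type*} (s : Finset ι) {f g : ι → ℝ} {a b c m α : ℝ}
    (hc : 0 ≤ c) (hα : 0 ≤ α) (hm : 0 ≤ m) (hf : ∀ i ∈ s, 0 ≤ f i)
    (hfg : ∀ i ∈ s, c * f i ≤ g i) (ha : 0 ≤ a) (hab : c * a ≤ b) :
    c ^ α * ((∑ i ∈ s, f i ^ α) + m * a ^ α) ≤ (∑ i ∈ s, g i ^ α) + m * b ^ α := by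
  have key : ∀ {x y : ℝ}, 0 ≤ x → c * x ≤ y → c ^ α * x ^ α ≤ y ^ α := fun hx hxy => by
    rw [← Real.mul_rpow hc hx]
    exact Real.rpow_le_rpow (mul_nonneg hc hx) hxy hα
  rw [mul_add, Finset.mul_sum, mul_left_comm]
  exact add_le_add (Finset.sum_le_sum fun i hi => key (hf i hi) (hfg i hi))
    (mul_le_mul_of_nonneg_left (key ha hab) hm)

/-- Two positive reals within a factor `c ^ α` of each other have logarithms within
`|α * logb b c|`. -/
theorem abs_logb_sub_logb_le {b c α x y : ℝ} (hb : 1 < b) (hc : 0 < c) (hx : 0 < x) (hy : 0 < y)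
    (hxy : c ^ α * x ≤ y) (hyx : c ^ α * y ≤ x) :
    |Real.logb b x - Real.logb b y| ≤ |α * Real.logb b c| := by
  have key : ∀ {u v : ℝ}, 0 < u → c ^ α * u ≤ v →
      α * Real.logb b c + Real.logb b u ≤ Real.logb b v := fun hu huv => by
    have hcα : 0 < c ^ α := Real.rpow_pos_of_pos hc α
    rw [← Real.logb_rpow_eq_mul_logb_of_pos hc, ← Real.logb_mul hcα.ne' hu.ne']
    exact Real.logb_le_logb_of_le hb (mul_pos hcα hu) huv
  have h1 := key hx hxy
  have h2 := key hy hyx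
  have h3 := neg_abs_le (α * Real.logb b c)
  rw [abs_le]
  constructor <;> linarith

/-- For an antitone sequence, the sum of the entries from index `k` on is at most `n - k` times
any of the first `k` entries. -/
theorem sum_sub_sum_filter_lt_le {n k : ℕ} (hk : k ≤ n) {f : Fin n → ℝ} (hf : Antitone f)
    {i : Fin n} (hi : (i : ℕ) < k) :
    ∑ j, f j - ∑ j ∈ Finset.univ.filter fun j : Fin n => (j : ℕ) < k, f j ≤
      ((n : ℝ) - (k : ℝ)) * f i := by
  have hsplit := Finset.sum_filter_add_sum_filter_not Finset.univ
    (fun j : Fin n => (j : ℕ) < k) f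
  have hcards := Finset.card_filter_add_card_filter_not (s := (Finset.univ : Finset (Fin n)))
    (fun j : Fin n => (j : ℕ) < k)
  rw [Fin.card_filter_val_lt, min_eq_right hk, Finset.card_univ, Fintype.card_fin] at hcards
  have hcard : ((Finset.univ.filter fun j : Fin n => ¬ (j : ℕ) < k).card : ℝ) = n - k := by
    rw [eq_sub_iff_add_eq']
    exact_mod_cast hcards
  have hle := Finset.sum_le_card_nsmul (Finset.univ.filter fun j : Fin n => ¬ (j : ℕ) < k) f (f i)
    fun j hj => hf (Fin.le_def.2 (by have := (Finset.mem_filter.1 hj).2; omega))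
  rw [nsmul_eq_mul, hcard] at hle
  linarith

/-- the deterministic final step of Theorems 2 and 3 of the paper:
if each of the `k` largest eigenvalues is approximated to absolute error `ε λ_r`, then
the complemented eigenvalue `λ̂_r` satisfies `|λ̂_r - λ_r| ≤ ε λ_r` and the exact and
approximate low-rank Rényi entropies differ by at most `|(α/(1-α)) log₂(1-ε)|`. -/
theorem lowRank_entropy_approx_bound {n : ℕ} (hn : 2 ≤ n) (k : ℕ)
    (hk1 : 1 ≤ k) (hk2 : 2 * k ≤ n)
    (α : ℝ) (hα : 0 < α) (hα1 : α ≠ 1)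
    (lam : Fin n → ℝ) (hanti : Antitone lam) (hnonneg : ∀ i, 0 ≤ lam i)
    (hsum : ∑ i, lam i = 1)
    (lamr : ℝ)
    (hlamr : lamr =
      (1 - ∑ i ∈ Finset.univ.filter fun i : Fin n => (i : ℕ) < k, lam i) / ((n : ℝ) - (k : ℝ)))
    (hlamrpos : 0 < lamr)
    (ε : ℝ) (hε : ε ∈ Set.Ioo (0 : ℝ) 1)
    (lamh : Fin n → ℝ)
    (hlamh : ∀ i : Fin n, (i : ℕ) < k → 0 ≤ lamh i ∧ |lamh i - lam i| ≤ ε * lamr)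
    (lamrh : ℝ)
    (hlamrh : lamrh =
      (1 - ∑ i ∈ Finset.univ.filter fun i : Fin n => (i : ℕ) < k, lamh i) / ((n : ℝ) - (k : ℝ))) :
    |lamrh - lamr| ≤ ε * lamr ∧
      |(1 / (1 - α)) * Real.logb 2
            ((∑ i ∈ Finset.univ.filter fun i : Fin n => (i : ℕ) < k, lam i ^ α) +
              ((n : ℝ) - (k : ℝ)) * lamr ^ α) -
          (1 / (1 - α)) * Real.logb 2
            ((∑ i ∈ Finset.univ.filter fun i : Fin n => (i : ℕ) < k, lamh i ^ α) +
              ((n : ℝ) - (k : ℝ)) * lamrh ^ α)| ≤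
        |(α / (1 - α)) * Real.logb 2 (1 - ε)| := by
  obtain ⟨hε0, hε1⟩ := hε
  have hkn : (2 : ℝ) * k ≤ n := by exact_mod_cast hk2
  have hk0 : (1 : ℝ) ≤ k := by exact_mod_cast hk1
  have hm : (0 : ℝ) < n - k := by linarith
  have hle : ∀ i : Fin n, (i : ℕ) < k → lamr ≤ lam i := fun i hi => by
    rw [hlamr, div_le_iff₀' hm, ← hsum]
    exact sum_sub_sum_filter_lt_le (by omega) hanti hi
  have herr : |lamrh - lamr| ≤ ε * lamr := by
    have hsub := (Finset.abs_sum_le_sum_abs (fun i => lamh i - lam i)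
      (Finset.univ.filter fun i : Fin n => (i : ℕ) < k)).trans
      (Finset.sum_le_card_nsmul _ _ (ε * lamr) fun i hi => (hlamh i (Finset.mem_filter.1 hi).2).2)
    rw [Fin.card_filter_val_lt, min_eq_right (by omega), nsmul_eq_mul, Finset.sum_sub_distrib]
      at hsub
    have hdiff : lamrh - lamr = -((∑ i ∈ Finset.univ.filter fun i : Fin n => (i : ℕ) < k, lamh i) -
        ∑ i ∈ Finset.univ.filter fun i : Fin n => (i : ℕ) < k, lam i) / ((n : ℝ) - k) := by
      rw [hlamrh, hlamr]
      ring
    rw [hdiff, abs_div, abs_neg, abs_of_pos hm, div_le_iff₀' hm]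
    exact hsub.trans (mul_le_mul_of_nonneg_right (by linarith) (by positivity))
  refine ⟨herr, ?_⟩
  have hc : 0 < 1 - ε := by linarith
  have lower : ∀ {x y : ℝ}, lamr ≤ x → |y - x| ≤ ε * lamr → (1 - ε) * x ≤ y := fun hx hxy => by
    have := (abs_le.1 hxy).1
    nlinarith
  have upper : ∀ {x y : ℝ}, lamr ≤ x → |y - x| ≤ ε * lamr → (1 - ε) * y ≤ x := fun hx hxy => by
    have := (abs_le.1 hxy).2
    nlinarith [mul_pos hε0 hε0]
  have hlamrh0 : 0 < lamrh := (mul_pos hc hlamrpos).trans_le (lower le_rfl herr)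
  have hmem : ∀ i ∈ Finset.univ.filter fun i : Fin n => (i : ℕ) < k, (i : ℕ) < k :=
    fun i hi => (Finset.mem_filter.1 hi).2
  have hT := rpow_mul_sum_rpow_le _ hc.le hα.le hm.le (fun i _ => hnonneg i)
    (fun i hi => lower (hle i (hmem i hi)) (hlamh i (hmem i hi)).2) hlamrpos.le (lower le_rfl herr)
  have hT' := rpow_mul_sum_rpow_le _ hc.le hα.le hm.le (fun i hi => (hlamh i (hmem i hi)).1)
    (fun i hi => upper (hle i (hmem i hi)) (hlamh i (hmem i hi)).2) hlamrh0.le (upper le_rfl herr)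
  have hpos := add_pos_of_nonneg_of_pos
    (Finset.sum_nonneg fun i (_ : i ∈ Finset.univ.filter fun i : Fin n => (i : ℕ) < k) =>
      Real.rpow_nonneg (hnonneg i) α) (mul_pos hm (Real.rpow_pos_of_pos hlamrpos α))
  have hpos' := add_pos_of_nonneg_of_pos
    (Finset.sum_nonneg fun i hi => Real.rpow_nonneg (hlamh i (hmem i hi)).1 α)
    (mul_pos hm (Real.rpow_pos_of_pos hlamrh0 α))
  rw [← mul_sub, div_eq_mul_one_div α, mul_comm α, mul_assoc, abs_mul, abs_mul (1 / (1 - α))]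
  exact mul_le_mul_of_nonneg_left (abs_logb_sub_logb_le one_lt_two hc hpos hpos' hT hT')
    (abs_nonneg _)
end

section
/- Let n ≥ 2 and let k be an integer with 1 ≤ k ≤ n−1. Let a_1 ≥ … ≥ a_n ≥ 0 and b_1 ≥ … ≥ b_n ≥ 0 be nonincreasing sequences with ∑_{i=1}^n a_i = ∑_{i=1}^n b_i = 1, and suppose ∑_{i=1}^t a_i ≤ ∑_{i=1}^t b_i for every t ∈ [1,k]. Define the low-rank completed sequences a' and b' by a'_i = a_i for i ≤ k and a'_i = a_r = (1/(n−k))(1 − ∑_{j=1}^k a_j) for i > k, and similarly for b'. Then ∑_{i=1}^t a'_i ≤ ∑_{i=1}^t b'_i for every t ∈ [1,n]. -/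
open scoped BigOperators

/-- Summing over the first `t` indices a sequence that agrees with `f` on the first `k ≤ t`
indices and is constant afterwards. -/
theorem sum_filter_lt_ite_const {n k t : ℕ} (hkt : k ≤ t) (htn : t ≤ n)
    (f : Fin n → ℝ) (c : ℝ) :
    (∑ i ∈ Finset.univ.filter fun i : Fin n => (i : ℕ) < t, if (i : ℕ) < k then f i else c) =
      (∑ i ∈ Finset.univ.filter fun i : Fin n => (i : ℕ) < k, f i) + ((t : ℝ) - k) * c := by
  have card_lt (m : ℕ) (hm : m ≤ n) :
      (Finset.univ.filter fun i : Fin n => (i : ℕ) < m).card = m := by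
    rw [Fin.card_filter_val_lt, min_eq_right hm]
  have hsub : (Finset.univ.filter fun i : Fin n => (i : ℕ) < k) ⊆
      Finset.univ.filter fun i : Fin n => (i : ℕ) < t :=
    Finset.monotone_filter_right _ fun _ _ h => lt_of_lt_of_le h hkt
  have hhead : ∀ i ∈ Finset.univ.filter fun i : Fin n => (i : ℕ) < k,
      (if (i : ℕ) < k then f i else c) = f i := fun i hi =>
    if_pos (Finset.mem_filter.mp hi).2
  have htail : ∀ i ∈ (Finset.univ.filter fun i : Fin n => (i : ℕ) < t) \
      Finset.univ.filter fun i : Fin n => (i : ℕ) < k,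
      (if (i : ℕ) < k then f i else c) = c := fun i hi =>
    if_neg fun h => (Finset.mem_sdiff.mp hi).2 (Finset.mem_filter.mpr ⟨Finset.mem_univ i, h⟩)
  rw [← Finset.sum_sdiff hsub, Finset.sum_congr rfl hhead, Finset.sum_congr rfl htail,
    Finset.sum_const, nsmul_eq_mul, Finset.card_sdiff_of_subset hsub, card_lt t htn,
    card_lt k (hkt.trans htn), Nat.cast_sub hkt, add_comm]

/-- partial-sum domination is preserved by low-rank completion, extracted
from the proofs of Proposition 1 (f), (g): if the partial sums of `a` are dominated by
those of `b` up to index `k`, then the partial sums of the low-rank completions `a'`, `b'`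
(keeping the first `k` entries and replacing the rest with their average) are dominated
for every `t ∈ [1, n]`. -/
theorem lowRank_completion_partialSum_mono {n : ℕ} (hn : 2 ≤ n) (k : ℕ)
    (hk1 : 1 ≤ k) (hkn : k ≤ n - 1)
    (a b : Fin n → ℝ)
    (ha_anti : Antitone a) (hb_anti : Antitone b)
    (ha_nonneg : ∀ i, 0 ≤ a i) (hb_nonneg : ∀ i, 0 ≤ b i)
    (ha_sum : ∑ i, a i = 1) (hb_sum : ∑ i, b i = 1)
    (hdom : ∀ t : ℕ, 1 ≤ t → t ≤ k →
      (∑ i ∈ Finset.univ.filter fun i : Fin n => (i : ℕ) < t, a i) ≤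
        ∑ i ∈ Finset.univ.filter fun i : Fin n => (i : ℕ) < t, b i) :
    ∀ t : ℕ, 1 ≤ t → t ≤ n →
      (∑ i ∈ Finset.univ.filter fun i : Fin n => (i : ℕ) < t,
          (if (i : ℕ) < k then a i else
            (1 - ∑ j ∈ Finset.univ.filter fun j : Fin n => (j : ℕ) < k, a j) /
              ((n : ℝ) - (k : ℝ)))) ≤
        ∑ i ∈ Finset.univ.filter fun i : Fin n => (i : ℕ) < t,
          (if (i : ℕ) < k then b i else
            (1 - ∑ j ∈ Finset.univ.filter fun j : Fin n => (j : ℕ) < k, b j) /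
              ((n : ℝ) - (k : ℝ))) := by
  intro t ht1 htn
  rcases le_total t k with htk | hkt
  · have hhead (f : Fin n → ℝ) (c : ℝ) :
        (∑ i ∈ Finset.univ.filter fun i : Fin n => (i : ℕ) < t,
          if (i : ℕ) < k then f i else c) =
        ∑ i ∈ Finset.univ.filter fun i : Fin n => (i : ℕ) < t, f i :=
      Finset.sum_congr rfl fun i hi =>
        if_pos (lt_of_lt_of_le (Finset.mem_filter.mp hi).2 htk)
    rw [hhead, hhead]
    exact hdom t ht1 htk
  · rw [sum_filter_lt_ite_const hkt htn, sum_filter_lt_ite_const hkt htn]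
    have hS := hdom k hk1 le_rfl
    generalize (∑ i ∈ Finset.univ.filter fun i : Fin n => (i : ℕ) < k, a i) = A at *
    generalize (∑ i ∈ Finset.univ.filter fun i : Fin n => (i : ℕ) < k, b i) = B at *
    have hpos : (0 : ℝ) < n - k := sub_pos.mpr (by exact_mod_cast (by omega : k < n))
    have htn' : (t : ℝ) ≤ n := by exact_mod_cast htn
    have hcoef : ((t : ℝ) - k) / (n - k) ≤ 1 := (div_le_one hpos).mpr (by linarith)
    have hdiff : B + ((t : ℝ) - k) * ((1 - B) / (n - k)) -
        (A + ((t : ℝ) - k) * ((1 - A) / (n - k))) =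
        (1 - ((t : ℝ) - k) / (n - k)) * (B - A) := by ring
    have := mul_nonneg (sub_nonneg.mpr hcoef) (sub_nonneg.mpr hS)
    linarith
end
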